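/- Let Σ ⋐ L and let v be a Σ-state. Up to isomorphism of labelled structures, there are only finitely many efficient paths (w_0, …, w_α) of Σ-states with w_0 = v. -/

import Mathlib

open scoped Classical

namespace Untangled

noncomputable section

/-- Formulas of the trimodal language `L`. -/
inductive Formula (PV : Type) : Type
  | var : PV → Formula PV
  | and : Formula PV → Formula PV → Formula PV
  | neg : Formula PV → Formula PV
  | dia : Formula PV → Formula PV
  | next : Formula PV → Formula PV
  | ev : Formula PV → Formula PV
  deriving DecidableEq

namespace Formula

variable {PV : Type}

/-- Implication `φ → ψ := ¬(φ ∧ ¬ψ)`. -/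
def impl (φ ψ : Formula PV) : Formula PV := .neg (.and φ (.neg ψ))

/-- Biconditional. -/
def fiff (φ ψ : Formula PV) : Formula PV := .and (impl φ ψ) (impl ψ φ)

/-- `□φ := ¬◇¬φ`. -/
def box (φ : Formula PV) : Formula PV := .neg (.dia (.neg φ))

/-- `■φ := ¬◆¬φ`. -/
def hence (φ : Formula PV) : Formula PV := .neg (.ev (.neg φ))

/-- The single negation of a formula: strip a leading negation if present,
otherwise negate. -/
def sneg : Formula PV → Formula PV
  | .neg φ => φ
  | φ => .neg φ

end Formula

/-- A formula is a propositional tautology if it evaluates to `true` under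
every Boolean valuation of formulas respecting `¬` and `∧`
(modal subformulas are treated as atoms). -/
def IsTautology {PV : Type} (φ : Formula PV) : Prop :=
  ∀ v : Formula PV → Bool,
    (∀ ψ : Formula PV, v ψ.neg = !v ψ) →
    (∀ ψ χ : Formula PV, v (ψ.and χ) = (v ψ && v χ)) →
    v φ = true

/-- The axiomatic system `DGL`. -/
inductive DGL {PV : Type} : Formula PV → Prop
  | taut {φ : Formula PV} : IsTautology φ → DGL φ
  | axK (φ ψ : Formula PV) : DGL (((φ.impl ψ).box).impl ((φ.box).impl ψ.box))
  | axL (φ : Formula PV) : DGL ((((φ.box).impl φ).box).impl φ.box)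
  | axNextNeg (φ : Formula PV) : DGL ((φ.next.neg).fiff (φ.neg.next))
  | axNextAnd (φ ψ : Formula PV) : DGL (((φ.and ψ).next).fiff ((φ.next).and (ψ.next)))
  | axC (φ : Formula PV) : DGL (((φ.next).and ((φ.box).next)).impl ((φ.next).box))
  | axKHence (φ ψ : Formula PV) : DGL (((φ.impl ψ).hence).impl ((φ.hence).impl (ψ.hence)))
  | axFix (φ : Formula PV) : DGL ((φ.hence).impl (φ.and ((φ.hence).next)))
  | axInd (φ : Formula PV) : DGL (((φ.impl φ.next).hence).impl (φ.impl φ.hence))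
  | mp {φ ψ : Formula PV} : DGL (φ.impl ψ) → DGL φ → DGL ψ
  | necBox {φ : Formula PV} : DGL φ → DGL φ.box
  | necNext {φ : Formula PV} : DGL φ → DGL φ.next
  | necHence {φ : Formula PV} : DGL φ → DGL φ.hence

/-- The Cantor derivative of a set: its set of limit points. -/
def cantorDeriv {X : Type*} [TopologicalSpace X] (A : Set X) : Set X :=
  {x | ∀ U : Set X, IsOpen U → x ∈ U → ∃ y, y ∈ U ∩ A ∧ y ≠ x}

/-- A topological space is scattered if every subset contained in its own
Cantor derivative is empty. -/
def Scattered (X : Type*) [TopologicalSpace X] : Prop :=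
  ∀ S : Set X, S ⊆ cantorDeriv S → S = ∅

/-- Truth sets in a dynamic topological model given by a (continuous) map `f`
and a valuation `ν`. -/
def truthSet {PV : Type} {X : Type*} [TopologicalSpace X] (f : X → X) (ν : PV → Set X) :
    Formula PV → Set X
  | .var p => ν p
  | .and φ ψ => truthSet f ν φ ∩ truthSet f ν ψ
  | .neg φ => (truthSet f ν φ)ᶜ
  | .dia φ => cantorDeriv (truthSet f ν φ)
  | .next φ => f ⁻¹' truthSet f ν φ
  | .ev φ => ⋃ n : ℕ, (f^[n]) ⁻¹' truthSet f ν φ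

/-- The downset topology of a (strict) order: open sets are the downward
closed sets. -/
def downsetTopology {X : Type*} (lt : X → X → Prop) : TopologicalSpace X where
  IsOpen U := ∀ x ∈ U, ∀ y, lt y x → y ∈ U
  isOpen_univ := fun _ _ y _ => Set.mem_univ y
  isOpen_inter := fun s t hs ht x hx y hy => ⟨hs x hx.1 y hy, ht x hx.2 y hy⟩
  isOpen_sUnion := fun S hS x hx y hy => by
    obtain ⟨t, htS, hxt⟩ := hx
    exact ⟨t, htS, hS t htS x hxt y hy⟩
/-- `Σ ⋐ L`: `Γ` is closed under subformulas and single negations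
(finiteness is expressed by `Γ : Finset _`). -/
structure GoodSigma {PV : Type} (Γ : Finset (Formula PV)) : Prop where
  and_cl : ∀ φ ψ : Formula PV, Formula.and φ ψ ∈ Γ → φ ∈ Γ ∧ ψ ∈ Γ
  neg_cl : ∀ φ : Formula PV, Formula.neg φ ∈ Γ → φ ∈ Γ
  dia_cl : ∀ φ : Formula PV, Formula.dia φ ∈ Γ → φ ∈ Γ
  next_cl : ∀ φ : Formula PV, Formula.next φ ∈ Γ → φ ∈ Γ
  ev_cl : ∀ φ : Formula PV, Formula.ev φ ∈ Γ → φ ∈ Γ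
  sneg_cl : ∀ φ ∈ Γ, Formula.sneg φ ∈ Γ

/-- `Φ` is a `Σ`-type over `Γ`. -/
structure IsType {PV : Type} (Γ : Finset (Formula PV)) (Φ : Finset (Formula PV)) : Prop where
  subset : Φ ⊆ Γ
  not_both : ∀ φ : Formula PV, ¬(φ ∈ Φ ∧ φ.neg ∈ Φ)
  dneg : ∀ φ : Formula PV, φ.neg.neg ∈ Φ → φ ∈ Φ
  and_mem : ∀ φ ψ : Formula PV, φ.and ψ ∈ Φ → φ ∈ Φ ∧ ψ ∈ Φ
  nand_mem : ∀ φ ψ : Formula PV, (φ.and ψ).neg ∈ Φ → φ.neg ∈ Φ ∨ ψ.neg ∈ Φ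
  hence_mem : ∀ φ : Formula PV, φ.hence ∈ Φ → φ ∈ Φ
  total : ∀ φ ∈ Γ, φ ∈ Φ ∨ Formula.sneg φ ∈ Φ

/-- A sensible pair of types. -/
structure SensiblePair {PV : Type} (Φ Ψ : Finset (Formula PV)) : Prop where
  next_mem : ∀ φ : Formula PV, φ.next ∈ Φ → φ ∈ Ψ
  next_neg : ∀ φ : Formula PV, φ.next.neg ∈ Φ → φ.neg ∈ Ψ
  ev_mem : ∀ φ : Formula PV, φ.ev ∈ Φ → φ ∈ Φ ∨ φ.ev ∈ Ψ
  hence_mem : ∀ φ : Formula PV, φ.hence ∈ Φ → φ.hence ∈ Ψ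

/-- The reflexive closure `≼` of a strict relation. -/
def Rle {W : Type*} (lt : W → W → Prop) (x y : W) : Prop := lt x y ∨ x = y

/-- `n`-fold composition of a relation. -/
def RelIter {W : Type*} (R : W → W → Prop) : ℕ → W → W → Prop
  | 0 => fun x y => x = y
  | n + 1 => fun x z => ∃ y, R x y ∧ RelIter R n y z

/-- A `Σ`-quasimodel: a locally finite `Σ`-labelled strict poset together with
an ω-sensible (serial, forward-confluent, sensible) transition relation. -/
structure Quasimodel (PV : Type) (Γ : Finset (Formula PV)) where
  good : GoodSigma Γ
  W : Type
  lt : W → W → Prop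
  lt_irrefl : ∀ w, ¬ lt w w
  lt_trans : ∀ u v w, lt u v → lt v w → lt u w
  locFin : ∀ w, Set.Finite {v | lt v w}
  label : W → Finset (Formula PV)
  label_type : ∀ w, IsType Γ (label w)
  label_dia : ∀ w (φ : Formula PV), φ.dia ∈ label w → ∃ v, lt v w ∧ φ ∈ label v
  label_box : ∀ w (φ : Formula PV), φ.box ∈ label w → ∀ v, lt v w → φ ∈ label v
  R : W → W → Prop
  R_fconf : ∀ w w' v, Rle lt w w' → R w v → ∃ v', R w' v' ∧ Rle lt v v'
  R_sens : ∀ w v, R w v → SensiblePair (label w) (label v)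
  R_serial : ∀ w, ∃ v, R w v
  R_omega : ∀ w (φ : Formula PV), φ.ev ∈ label w →
      ∃ n v, RelIter R n w v ∧ φ ∈ label v

variable {PV : Type} {Γ : Finset (Formula PV)}

/-- An infinite path in a quasimodel. -/
def IsPath (Q : Quasimodel PV Γ) (π : ℕ → Q.W) : Prop := ∀ n, Q.R (π n) (π (n + 1))

/-- A realising path in a quasimodel. -/
def IsRealising (Q : Quasimodel PV Γ) (π : ℕ → Q.W) : Prop :=
  IsPath Q π ∧ ∀ m (φ : Formula PV), φ.ev ∈ Q.label (π m) → ∃ k ≥ m, φ ∈ Q.label (π k)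

/-- The set (type) `|Q⃗|` of realising paths of `Q`. -/
def RPath (Q : Quasimodel PV Γ) : Type := {π : ℕ → Q.W // IsRealising Q π}

theorem isRealising_shift (Q : Quasimodel PV Γ) (π : ℕ → Q.W) (h : IsRealising Q π) :
    IsRealising Q (fun n => π (n + 1)) := by
  constructor
  · intro n
    exact h.1 (n + 1)
  · intro m φ hm
    obtain ⟨k, hk, hφ⟩ := h.2 (m + 1) φ hm
    refine ⟨k - 1, by omega, ?_⟩
    have hk1 : k - 1 + 1 = k := by omega
    simpa [hk1] using hφ

/-- The shift map `σ` on realising paths. -/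
def shift (Q : Quasimodel PV Γ) (π : RPath Q) : RPath Q :=
  ⟨fun n => π.1 (n + 1), isRealising_shift Q π.1 π.2⟩

/-- The basic `m`-neighbourhood `N_m(π)` of a realising path. -/
def Nbhd (Q : Quasimodel PV Γ) (π : RPath Q) (m : ℕ) : Set (RPath Q) :=
  {ρ | (∀ i < m, Rle Q.lt (ρ.1 i) (π.1 i)) ∧
       (∀ k < m, ρ.1 k = π.1 k → ∀ j ≥ k, ρ.1 j = π.1 j)}

/-- The topology `T⃗_≺` on `|Q⃗|`, generated by the `m`-neighbourhoods. -/
def limitTopology (Q : Quasimodel PV Γ) : TopologicalSpace (RPath Q) :=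
  TopologicalSpace.generateFrom {B | ∃ π m, B = Nbhd Q π m}

/-- The valuation of the limit model. -/
def limitVal (Q : Quasimodel PV Γ) (p : PV) : Set (RPath Q) :=
  {π | Formula.var p ∈ Q.label (π.1 0)}
/-- A `Σ`-state: a finite rooted `Σ`-labelled strict poset (carrier a finite
set of naturals). -/
structure SState (PV : Type) (Γ : Finset (Formula PV)) where
  carrier : Finset ℕ
  lt : ℕ → ℕ → Prop
  lt_irrefl : ∀ a, ¬ lt a a
  lt_trans : ∀ a b c, lt a b → lt b c → lt a c
  label : ℕ → Finset (Formula PV)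
  label_type : ∀ a ∈ carrier, IsType Γ (label a)
  label_dia : ∀ a ∈ carrier, ∀ φ : Formula PV, φ.dia ∈ label a →
      ∃ b ∈ carrier, lt b a ∧ φ ∈ label b
  label_box : ∀ a ∈ carrier, ∀ φ : Formula PV, φ.box ∈ label a →
      ∀ b ∈ carrier, lt b a → φ ∈ label b
  root : ℕ
  root_mem : root ∈ carrier
  root_top : ∀ a ∈ carrier, a ≠ root → lt a root

namespace SState

variable {PV : Type} {Γ : Finset (Formula PV)}

/-- The label `ℓ(w)` of the root of a state. -/
def topLabel (w : SState PV Γ) : Finset (Formula PV) := w.label w.root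

/-- The canonical substate of `w` rooted at `x ∈ |w|`. -/
def substateAt (w : SState PV Γ) (x : ℕ) (hx : x ∈ w.carrier) : SState PV Γ where
  carrier := w.carrier.filter (fun u => w.lt u x ∨ u = x)
  lt := w.lt
  lt_irrefl := w.lt_irrefl
  lt_trans := w.lt_trans
  label := w.label
  label_type := fun a ha => w.label_type a (Finset.mem_filter.mp ha).1
  label_dia := fun a ha φ hφ => by
    obtain ⟨ha1, ha2⟩ := Finset.mem_filter.mp ha
    obtain ⟨b, hb, hlt, hφb⟩ := w.label_dia a ha1 φ hφ
    refine ⟨b, Finset.mem_filter.mpr ⟨hb, ?_⟩, hlt, hφb⟩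
    rcases ha2 with h | h
    · exact Or.inl (w.lt_trans _ _ _ hlt h)
    · exact Or.inl (h ▸ hlt)
  label_box := fun a ha φ hφ b hb hlt =>
    w.label_box a (Finset.mem_filter.mp ha).1 φ hφ b (Finset.mem_filter.mp hb).1 hlt
  root := x
  root_mem := Finset.mem_filter.mpr ⟨hx, Or.inr rfl⟩
  root_top := fun a ha hne => by
    rcases (Finset.mem_filter.mp ha).2 with h | h
    · exact h
    · exact absurd h hne

theorem substateAt_card_lt (w : SState PV Γ) (x : ℕ) (hx : x ∈ w.carrier.erase w.root) :
    (w.substateAt x (Finset.mem_of_mem_erase hx)).carrier.card < w.carrier.card := by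
  apply Finset.card_lt_card
  rw [substateAt, Finset.filter_ssubset]
  refine ⟨w.root, w.root_mem, ?_⟩
  rintro (h | h)
  · exact w.lt_irrefl _ (w.lt_trans _ _ _ h
      (w.root_top x (Finset.mem_of_mem_erase hx) (Finset.ne_of_mem_erase hx)))
  · exact (Finset.ne_of_mem_erase hx) h.symm

end SState

/-- The verum formula `¬(p₀ ∧ ¬p₀)`. -/
def fTop (PV : Type) [Inhabited PV] : Formula PV :=
  Formula.neg (Formula.and (Formula.var default) (Formula.neg (Formula.var default)))

/-- The falsum formula `p₀ ∧ ¬p₀`. -/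
def fBot (PV : Type) [Inhabited PV] : Formula PV :=
  Formula.and (Formula.var default) (Formula.neg (Formula.var default))

/-- Finite conjunction of a list of formulas. -/
def bigAnd {PV : Type} [Inhabited PV] (l : List (Formula PV)) : Formula PV :=
  l.foldr Formula.and (fTop PV)

/-- Finite disjunction of a list of formulas (`φ ∨ ψ := ¬(¬φ ∧ ¬ψ)`). -/
def bigOr {PV : Type} [Inhabited PV] (l : List (Formula PV)) : Formula PV :=
  l.foldr (fun φ ψ => Formula.neg (Formula.and (Formula.neg φ) (Formula.neg ψ))) (fBot PV)

/-- The simulation formula `Sim(w) := ⋀ℓ_w(0_w) ∧ ⋀_{v ≺ w} ◇Sim(v)`. -/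
def Sim {PV : Type} [Inhabited PV] [DecidableEq PV] {Γ : Finset (Formula PV)}
    (w : SState PV Γ) : Formula PV :=
  Formula.and (bigAnd (w.label w.root).toList)
    (bigAnd (((w.carrier.erase w.root).attach.toList).map
      (fun x => Formula.dia (Sim (w.substateAt x.1 (Finset.mem_of_mem_erase x.2))))))
termination_by w.carrier.card
decreasing_by
  exact SState.substateAt_card_lt w x.1 x.2
/-- `Simulates w v` (`w ◁ v`): there is a labelled simulation `χ ⊆ |w| × |v|`
with `0_w χ 0_v` (label-preserving and strictly forward-confluent). -/
def Simulates {PV : Type} {Γ : Finset (Formula PV)} (w v : SState PV Γ) : Prop :=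
  ∃ χ : ℕ → ℕ → Prop,
    (∀ a b, χ a b → a ∈ w.carrier ∧ b ∈ v.carrier) ∧
    (∀ a b, χ a b → w.label a = v.label b) ∧
    (∀ a' a b, χ a b → w.lt a' a → a' ∈ w.carrier →
      ∃ b' ∈ v.carrier, v.lt b' b ∧ χ a' b') ∧
    χ w.root v.root

/-- `Substate v w` (`v ≺ w`): `v` is the generated substructure of `w` whose
domain is `{u : u ≼_w 0_v}`, for some non-root `0_v ∈ |w|`. -/
def Substate {PV : Type} {Γ : Finset (Formula PV)} (v w : SState PV Γ) : Prop :=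
  v.root ∈ w.carrier ∧ v.root ≠ w.root ∧
  v.carrier = w.carrier.filter (fun u => w.lt u v.root ∨ u = v.root) ∧
  (∀ a ∈ v.carrier, ∀ b ∈ v.carrier, (v.lt a b ↔ w.lt a b)) ∧
  (∀ a ∈ v.carrier, v.label a = w.label a)

/-- `hgt(w)`: the maximal length of a `≺`-chain in `|w|`. -/
def hgt {PV : Type} {Γ : Finset (Formula PV)} (w : SState PV Γ) : ℕ :=
  sSup {n | ∃ c : ℕ → ℕ, (∀ i < n, c i ∈ w.carrier) ∧
    ∀ i j, i < j → j < n → w.lt (c i) (c j)}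

/-- `y` is a daughter of `x` in `w`: an immediate `≺`-predecessor. -/
def IsDaughter {PV : Type} {Γ : Finset (Formula PV)} (w : SState PV Γ) (y x : ℕ) : Prop :=
  y ∈ w.carrier ∧ w.lt y x ∧ ¬ ∃ z ∈ w.carrier, w.lt y z ∧ w.lt z x

/-- `wdt(w)`: the maximal number of pairwise `≺`-incomparable daughters of a
point of `w`. -/
def wdt {PV : Type} {Γ : Finset (Formula PV)} (w : SState PV Γ) : ℕ :=
  sSup {n | ∃ x ∈ w.carrier, ∃ D : Finset ℕ, D.card = n ∧
    (∀ y ∈ D, IsDaughter w y x) ∧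
    ∀ y ∈ D, ∀ z ∈ D, y ≠ z → ¬ w.lt y z ∧ ¬ w.lt z y}

/-- The norm `‖w‖ = max(hgt(w), wdt(w))` of a state. -/
def snorm {PV : Type} {Γ : Finset (Formula PV)} (w : SState PV Γ) : ℕ :=
  max (hgt w) (wdt w)

/-- `MapsTo w v` (`w ↦ v`): there is a sensible (forward-confluent,
label-sensible) relation `R ⊆ |w| × |v|` with `0_w R 0_v`. -/
def MapsTo {PV : Type} {Γ : Finset (Formula PV)} (w v : SState PV Γ) : Prop :=
  ∃ R : ℕ → ℕ → Prop,
    (∀ a b, R a b → a ∈ w.carrier ∧ b ∈ v.carrier) ∧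
    (∀ a b, R a b → SensiblePair (w.label a) (v.label b)) ∧
    (∀ a a' b, R a b → Rle w.lt a a' → a' ∈ w.carrier → ∃ b', R a' b' ∧ Rle v.lt b b') ∧
    R w.root v.root

/-- The set `{◇φ : ◇φ ∈ ℓ_w(u) for some u ∈ |w|}`. -/
def diaSet {PV : Type} [DecidableEq PV] {Γ : Finset (Formula PV)} (w : SState PV Γ) :
    Finset (Formula PV) :=
  w.carrier.biUnion fun u => (w.label u).filter fun φ => ∃ ψ : Formula PV, φ = Formula.dia ψ

/-- `BFuture w v` (`w ⇝ v`): `v` is a bounded future of `w`. -/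
def BFuture {PV : Type} [DecidableEq PV] {Γ : Finset (Formula PV)} (w v : SState PV Γ) : Prop :=
  MapsTo w v ∧ snorm v ≤ snorm w + (diaSet w).card

/-- A state is consistent if the negation of its simulation formula is not
derivable in `DGL`. -/
def Consistent {PV : Type} [Inhabited PV] [DecidableEq PV] {Γ : Finset (Formula PV)}
    (w : SState PV Γ) : Prop :=
  ¬ DGL (Formula.neg (Sim w))

/-- Isomorphism of `Σ`-states (as rooted labelled posets). -/
def SIso {PV : Type} {Γ : Finset (Formula PV)} (w v : SState PV Γ) : Prop :=
  ∃ g : ℕ → ℕ,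
    Set.BijOn g ↑w.carrier ↑v.carrier ∧ g w.root = v.root ∧
    (∀ a ∈ w.carrier, ∀ b ∈ w.carrier, (w.lt a b ↔ v.lt (g a) (g b))) ∧
    (∀ a ∈ w.carrier, w.label a = v.label (g a))

/-- An efficient path of `Σ`-states: consecutive states are bounded futures
and no earlier state simulates a later one. -/
def EfficientPath {PV : Type} [DecidableEq PV] {Γ : Finset (Formula PV)}
    (l : List (SState PV Γ)) : Prop :=
  l.Chain' BFuture ∧
  ∀ (i j : ℕ) (hi : i < l.length) (hj : j < l.length), i < j →
    ¬ Simulates (l.get ⟨i, hi⟩) (l.get ⟨j, hj⟩)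

/-- `v ∈ ρ(w)`: `v` is efficiently reachable from `w`, i.e. some efficient
path of consistent states leads from `w` to `v`. -/
def EffReachable {PV : Type} [Inhabited PV] [DecidableEq PV] {Γ : Finset (Formula PV)}
    (w v : SState PV Γ) : Prop :=
  ∃ l : List (SState PV Γ), EfficientPath l ∧ (∀ u ∈ l, Consistent u) ∧
    l.head? = some w ∧ l.getLast? = some v

/-- `χ` is a labelled simulation between the carriers of `w` and `v`
(with no condition on the roots). -/
def IsSimulation (w v : SState PV Γ) (χ : ℕ → ℕ → Prop) : Prop :=
  (∀ a b, χ a b → a ∈ w.carrier ∧ b ∈ v.carrier) ∧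
  (∀ a b, χ a b → w.label a = v.label b) ∧
  ∀ a' a b, χ a b → w.lt a' a → a' ∈ w.carrier → ∃ b' ∈ v.carrier, v.lt b' b ∧ χ a' b'

/-- Some labelled simulation relates the root of `w` to some point of `v`. -/
def Embeds (w v : SState PV Γ) : Prop :=
  ∃ χ, IsSimulation w v χ ∧ ∃ y, χ w.root y

theorem simulates_iff {w v : SState PV Γ} :
    Simulates w v ↔ ∃ χ, IsSimulation w v χ ∧ χ w.root v.root := by
  simp only [Simulates, IsSimulation, and_assoc]

theorem IsSimulation.comp {w v u : SState PV Γ} {χ ξ : ℕ → ℕ → Prop}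
    (hχ : IsSimulation w v χ) (hξ : IsSimulation v u ξ) :
    IsSimulation w u (fun a c => ∃ b, χ a b ∧ ξ b c) := by
  refine ⟨?_, ?_, ?_⟩
  · rintro a c ⟨b, hab, hbc⟩
    exact ⟨(hχ.1 a b hab).1, (hξ.1 b c hbc).2⟩
  · rintro a c ⟨b, hab, hbc⟩
    exact (hχ.2.1 a b hab).trans (hξ.2.1 b c hbc)
  · rintro a' a c ⟨b, hab, hbc⟩ hlt ha'
    obtain ⟨b', hb', hltb, hab'⟩ := hχ.2.2 a' a b hab hlt ha'
    obtain ⟨c', hc', hltc, hbc'⟩ := hξ.2.2 b' b c hbc hltb hb'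
    exact ⟨c', hc', hltc, b', hab', hbc'⟩

theorem isSimulation_eq (w : SState PV Γ) :
    IsSimulation w w (fun a b => a = b ∧ a ∈ w.carrier) := by
  refine ⟨?_, ?_, ?_⟩
  · rintro a b ⟨rfl, ha⟩
    exact ⟨ha, ha⟩
  · rintro a b ⟨rfl, -⟩
    rfl
  · rintro a' a b ⟨rfl, -⟩ hlt ha'
    exact ⟨a', ha', hlt, rfl, ha'⟩

theorem Simulates.trans {w v u : SState PV Γ} (h : Simulates w v) (h' : Simulates v u) :
    Simulates w u := by
  rw [simulates_iff] at *
  obtain ⟨χ, hχ, h₀⟩ := h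
  obtain ⟨ξ, hξ, h₁⟩ := h'
  exact ⟨_, hχ.comp hξ, _, h₀, h₁⟩

theorem Simulates.embeds {w v : SState PV Γ} (h : Simulates w v) : Embeds w v := by
  obtain ⟨χ, hχ, h₀⟩ := simulates_iff.1 h
  exact ⟨χ, hχ, _, h₀⟩

theorem mem_carrier_substateAt {w : SState PV Γ} {x : ℕ} {hx : x ∈ w.carrier} {a : ℕ} :
    a ∈ (w.substateAt x hx).carrier ↔ a ∈ w.carrier ∧ (w.lt a x ∨ a = x) := by
  simp [SState.substateAt]

theorem mem_substateAt_of_lt {w : SState PV Γ} {x : ℕ} {hx : x ∈ w.carrier} {a a' : ℕ}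
    (ha : a ∈ (w.substateAt x hx).carrier) (ha' : a' ∈ w.carrier) (h : w.lt a' a) :
    a' ∈ (w.substateAt x hx).carrier := by
  rw [mem_carrier_substateAt] at *
  refine ⟨ha', Or.inl ?_⟩
  rcases ha.2 with h' | rfl
  · exact w.lt_trans _ _ _ h h'
  · exact h

theorem embeds_substateAt (w : SState PV Γ) (x : ℕ) (hx : x ∈ w.carrier) :
    Embeds (w.substateAt x hx) w := by
  refine ⟨fun a b => a = b ∧ a ∈ (w.substateAt x hx).carrier, ⟨?_, ?_, ?_⟩,
    x, rfl, (w.substateAt x hx).root_mem⟩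
  · rintro a b ⟨rfl, ha⟩
    exact ⟨ha, (mem_carrier_substateAt.1 ha).1⟩
  · rintro a b ⟨rfl, -⟩
    rfl
  · rintro a' a b ⟨rfl, -⟩ hlt ha'
    exact ⟨a', (mem_carrier_substateAt.1 ha').1, hlt, rfl, ha'⟩

theorem IsSimulation.of_substateAt {w v : SState PV Γ} {x y : ℕ} {hx : x ∈ w.carrier}
    {hy : y ∈ v.carrier} {χ : ℕ → ℕ → Prop}
    (h : IsSimulation (w.substateAt x hx) (v.substateAt y hy) χ) : IsSimulation w v χ := by
  refine ⟨fun a b hab => ?_, h.2.1, fun a' a b hab hlt ha' => ?_⟩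
  · exact ⟨(mem_carrier_substateAt.1 (h.1 a b hab).1).1,
      (mem_carrier_substateAt.1 (h.1 a b hab).2).1⟩
  · obtain ⟨b', hb', hlt', hab'⟩ :=
      h.2.2 a' a b hab hlt (mem_substateAt_of_lt (h.1 a b hab).1 ha' hlt)
    exact ⟨b', (mem_carrier_substateAt.1 hb').1, hlt', hab'⟩

theorem SState.lt_root_of_lt {w : SState PV Γ} {a x : ℕ}
    (hx : w.lt x w.root) (hax : w.lt a x ∨ a = x) : w.lt a w.root := by
  rcases hax with h | rfl
  · exact w.lt_trans _ _ _ h hx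
  · exact hx

theorem simulates_of_forall_embeds {w v : SState PV Γ}
    (hl : w.label w.root = v.label v.root)
    (h : ∀ x (hx : x ∈ w.carrier), x ≠ w.root → ∃ y, ∃ hy : y ∈ v.carrier, y ≠ v.root ∧
      Embeds (w.substateAt x hx) (v.substateAt y hy)) : Simulates w v := by
  rw [simulates_iff]
  refine ⟨fun a b => (a = w.root ∧ b = v.root) ∨ ∃ χ, IsSimulation w v χ ∧ χ a b,
    ⟨?_, ?_, ?_⟩, Or.inl ⟨rfl, rfl⟩⟩
  · rintro a b (⟨rfl, rfl⟩ | ⟨χ, hχ, hab⟩)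
    · exact ⟨w.root_mem, v.root_mem⟩
    · exact hχ.1 a b hab
  · rintro a b (⟨rfl, rfl⟩ | ⟨χ, hχ, hab⟩)
    · exact hl
    · exact hχ.2.1 a b hab
  · rintro a' a b (⟨rfl, rfl⟩ | ⟨χ, hχ, hab⟩) hlt ha'
    · have hne : a' ≠ w.root := by
        rintro rfl
        exact w.lt_irrefl _ hlt
      obtain ⟨y, hy, hyne, χ, hχ, z, hz⟩ := h a' ha' hne
      have hzy := mem_carrier_substateAt.1 (hχ.1 _ _ hz).2
      exact ⟨z, hzy.1, SState.lt_root_of_lt (v.root_top y hy hyne) hzy.2,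
        Or.inr ⟨χ, hχ.of_substateAt, hz⟩⟩
    · obtain ⟨b', hb', hlt', hab'⟩ := hχ.2.2 a' a b hab hlt ha'
      exact ⟨b', hb', hlt', Or.inr ⟨χ, hχ, hab'⟩⟩

theorem Embeds.trans {w v u : SState PV Γ} (h : Embeds w v) (h' : Embeds v u) :
    Embeds w u := by
  obtain ⟨χ, hχ, y, hy⟩ := h
  obtain ⟨ξ, hξ, z, hz⟩ := h'
  have hyv := (hχ.1 _ _ hy).2
  have hex : ∃ z', ξ y z' := by
    by_cases hyr : y = v.root
    · exact ⟨z, hyr ▸ hz⟩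
    · obtain ⟨z', -, -, hz'⟩ := hξ.2.2 y v.root z hz (v.root_top y hyv hyr) hyv
      exact ⟨z', hz'⟩
  obtain ⟨z', hz'⟩ := hex
  exact ⟨_, hχ.comp hξ, z', y, hy, hz'⟩

instance isPreorder_embeds : IsPreorder (SState PV Γ) Embeds where
  refl w := ⟨_, isSimulation_eq w, w.root, rfl, w.root_mem⟩
  trans _ _ _ h h' := h.trans h'

/-- The list of all proper substates of a state. -/
def SState.properSubstates (w : SState PV Γ) : List (SState PV Γ) :=
  (w.carrier.erase w.root).attach.toList.map
    fun x => w.substateAt x.1 (Finset.mem_of_mem_erase x.2)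

theorem mem_properSubstates {w u : SState PV Γ} :
    u ∈ w.properSubstates ↔ ∃ x, ∃ hx : x ∈ w.carrier, x ≠ w.root ∧ w.substateAt x hx = u := by
  simp only [SState.properSubstates, List.mem_map, Finset.mem_toList, Finset.mem_attach, true_and,
    Subtype.exists, Finset.mem_erase]
  constructor
  · rintro ⟨x, ⟨h1, h2⟩, rfl⟩
    exact ⟨x, h2, h1, rfl⟩
  · rintro ⟨x, h2, h1, rfl⟩
    exact ⟨x, ⟨h1, h2⟩, rfl⟩

theorem simulates_of_sublistForall₂ {w v : SState PV Γ} (hl : w.label w.root = v.label v.root)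
    (h : List.SublistForall₂ Embeds w.properSubstates v.properSubstates) : Simulates w v := by
  refine simulates_of_forall_embeds hl fun x hx hxr => ?_
  obtain ⟨l, hl₁, hl₂⟩ := List.sublistForall₂_iff.1 h
  have key : ∀ {l₁ l₂ : List (SState PV Γ)}, List.Forall₂ Embeds l₁ l₂ →
      ∀ a ∈ l₁, ∃ b ∈ l₂, Embeds a b := by
    intro l₁ l₂ h12
    induction h12 with
    | nil => simp
    | cons hab _ ih =>
      intro a ha
      rcases List.mem_cons.1 ha with rfl | ha
      · exact ⟨_, List.mem_cons_self, hab⟩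
      · obtain ⟨b, hb, hab⟩ := ih a ha
        exact ⟨b, List.mem_cons_of_mem _ hb, hab⟩
  obtain ⟨b, hb, hemb⟩ := key hl₁ _ (mem_properSubstates.2 ⟨x, hx, hxr, rfl⟩)
  obtain ⟨y, hy, hyr, rfl⟩ := mem_properSubstates.1 (hl₂.subset hb)
  exact ⟨y, hy, hyr, hemb⟩

theorem exists_lt_simulates_of_substates {T : Set (SState PV Γ)}
    (hT : T.PartiallyWellOrderedOn Embeds) (f : ℕ → SState PV Γ)
    (hf : ∀ n, ∀ u ∈ (f n).properSubstates, u ∈ T) :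
    ∃ i j, i < j ∧ Simulates (f i) (f j) := by
  have : IsPreorder (List (SState PV Γ)) (List.SublistForall₂ Embeds) := { }
  obtain ⟨g, hg⟩ :=
    (Set.PartiallyWellOrderedOn.partiallyWellOrderedOn_sublistForall₂ Embeds
      hT).exists_monotone_subseq (f := fun n => (f n).properSubstates) hf
  obtain ⟨i, j, hij, heq⟩ := (Γ.powerset.finite_toSet).exists_lt_map_eq_of_forall_mem
    (f := fun n => (f (g n)).label (f (g n)).root)
    (fun n => by simpa using ((f (g n)).label_type _ (f (g n)).root_mem).subset)
  exact ⟨g i, g j, g.lt_iff_lt.2 hij, simulates_of_sublistForall₂ heq (hg i j hij.le)⟩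

theorem partiallyWellOrderedOn_embeds :
    (Set.univ : Set (SState PV Γ)).PartiallyWellOrderedOn Embeds := by
  rw [Set.PartiallyWellOrderedOn.iff_not_exists_isMinBadSeq fun w => w.carrier.card]
  rintro ⟨f, hbad, hmin⟩
  have hT : {u | ∃ n, u ∈ (f n).properSubstates}.PartiallyWellOrderedOn Embeds := by
    rw [Set.PartiallyWellOrderedOn.iff_forall_not_isBadSeq]
    rintro h ⟨hmem, hhbad⟩
    choose idx hidx using hmem
    have hemb : ∀ k, Embeds (h k) (f (idx k)) := fun k => by
      obtain ⟨x, hx, -, hxe⟩ := mem_properSubstates.1 (hidx k)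
      exact hxe ▸ embeds_substateAt _ x hx
    obtain ⟨k₀, hk₀⟩ : ∃ k₀, ∀ k, idx k₀ ≤ idx k :=
      ⟨Function.argmin idx, fun k => Function.argmin_le idx k⟩
    refine hmin (idx k₀) (fun n => if n < idx k₀ then f n else h (k₀ + (n - idx k₀)))
      (fun m hm => (if_pos hm).symm) ?_ ⟨fun _ => trivial, fun m n hmn hE => ?_⟩
    · obtain ⟨x, hx, hxr, hxe⟩ := mem_properSubstates.1 (hidx k₀)
      simp only [lt_irrefl, if_false, Nat.sub_self, Nat.add_zero]
      rw [← hxe]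
      exact SState.substateAt_card_lt _ x (Finset.mem_erase.2 ⟨hxr, hx⟩)
    · by_cases hn : n < idx k₀
      · simp only [if_pos hn, if_pos (hmn.trans hn)] at hE
        exact hbad.2 m n hmn hE
      · by_cases hm : m < idx k₀
        · simp only [if_pos hm, if_neg hn] at hE
          exact hbad.2 _ _ (hm.trans_le (hk₀ _)) (hE.trans (hemb _))
        · simp only [if_neg hm, if_neg hn] at hE
          exact hhbad _ _ (by omega) hE
  obtain ⟨i, j, hij, hS⟩ := exists_lt_simulates_of_substates hT f fun n u hu => ⟨n, hu⟩
  exact hbad.2 i j hij hS.embeds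

/-- Simulation is a well-quasi-order on `Σ`-states. -/
theorem wellQuasiOrdered_simulates : WellQuasiOrdered (Simulates (PV := PV) (Γ := Γ)) :=
  fun f => exists_lt_simulates_of_substates partiallyWellOrderedOn_embeds f
    fun _ _ _ => trivial

theorem SIso.simulates {w v : SState PV Γ} (h : SIso w v) : Simulates w v ∧ Simulates v w := by
  obtain ⟨g, hg, hr, hlt, hl⟩ := h
  refine ⟨⟨fun a b => a ∈ w.carrier ∧ b = g a, ?_, ?_, ?_, w.root_mem, hr.symm⟩,
    ⟨fun b a => a ∈ w.carrier ∧ b = g a, ?_, ?_, ?_, w.root_mem, hr.symm⟩⟩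
  · rintro a _ ⟨ha, rfl⟩
    exact ⟨ha, hg.mapsTo ha⟩
  · rintro a _ ⟨ha, rfl⟩
    exact hl a ha
  · rintro a' a _ ⟨ha, rfl⟩ h ha'
    exact ⟨g a', hg.mapsTo ha', (hlt a' ha' a ha).1 h, ha', rfl⟩
  · rintro _ a ⟨ha, rfl⟩
    exact ⟨hg.mapsTo ha, ha⟩
  · rintro _ a ⟨ha, rfl⟩
    exact (hl a ha).symm
  · rintro b' _ a ⟨ha, rfl⟩ h hb'
    obtain ⟨a', ha', rfl⟩ := hg.surjOn hb'
    exact ⟨a', ha', (hlt a' ha' a ha).2 h, ha', rfl⟩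

/-- `e` enumerates the carrier of `w`, transporting its structure to `c`. -/
def IsCoding {n : ℕ} (w : SState PV Γ) (e : Fin n → ℕ)
    (c : (Fin n → Fin n → Prop) × (Fin n → Γ.powerset) × Fin n) : Prop :=
  Function.Injective e ∧ Set.range e = ↑w.carrier ∧ (∀ i j, w.lt (e i) (e j) ↔ c.1 i j) ∧
    (∀ i, w.label (e i) = (c.2.1 i : Finset (Formula PV))) ∧ w.root = e c.2.2

theorem exists_isCoding (w : SState PV Γ) :
    ∃ (e : Fin w.carrier.card → ℕ) (c : _), IsCoding w e c := by
  let e := w.carrier.equivFin.symm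
  have he : ∀ i, (e i : ℕ) ∈ w.carrier := fun i => (e i).2
  refine ⟨fun i => e i, ⟨fun i j => w.lt (e i) (e j), fun i => ⟨w.label (e i), ?_⟩,
    e.symm ⟨w.root, w.root_mem⟩⟩, ?_, ?_, fun _ _ => Iff.rfl, fun _ => rfl, ?_⟩
  · exact Finset.mem_powerset.2 (w.label_type _ (he i)).subset
  · exact Subtype.val_injective.comp e.injective
  · ext a
    constructor
    · rintro ⟨i, rfl⟩
      exact he i
    · intro ha
      exact ⟨e.symm ⟨a, ha⟩, by simp⟩
  · simp

theorem IsCoding.sIso {n : ℕ} {w v : SState PV Γ} {e e' : Fin n → ℕ}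
    {c : (Fin n → Fin n → Prop) × (Fin n → Γ.powerset) × Fin n}
    (h : IsCoding w e c) (h' : IsCoding v e' c) : SIso w v := by
  obtain ⟨hi, hr, hlt, hl, hroot⟩ := h
  obtain ⟨hi', hr', hlt', hl', hroot'⟩ := h'
  have hg : ∀ i, Function.extend e e' (fun _ => 0) (e i) = e' i := fun i => hi.extend_apply _ _ i
  have hmem : ∀ a ∈ w.carrier, ∃ i, e i = a := fun a ha => by
    have : a ∈ Set.range e := hr ▸ ha
    exact this
  refine ⟨Function.extend e e' fun _ => 0, ⟨?_, ?_, ?_⟩, ?_, ?_, ?_⟩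
  · intro a ha
    obtain ⟨i, rfl⟩ := hmem a ha
    rw [hg, ← hr']
    exact ⟨i, rfl⟩
  · intro a ha b hb hab
    obtain ⟨i, rfl⟩ := hmem a ha
    obtain ⟨j, rfl⟩ := hmem b hb
    rw [hg, hg] at hab
    rw [hi' hab]
  · intro b hb
    rw [← hr'] at hb
    obtain ⟨i, rfl⟩ := hb
    exact ⟨e i, hr ▸ ⟨i, rfl⟩, hg i⟩
  · rw [hroot, hg, hroot']
  · intro a ha b hb
    obtain ⟨i, rfl⟩ := hmem a ha
    obtain ⟨j, rfl⟩ := hmem b hb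
    rw [hg, hg, hlt, hlt']
  · intro a ha
    obtain ⟨i, rfl⟩ := hmem a ha
    rw [hg, hl, hl']

theorem exists_finite_representatives_of_card_eq (n : ℕ) :
    ∃ S : Set (SState PV Γ), S.Finite ∧
      ∀ w : SState PV Γ, w.carrier.card = n → ∃ r ∈ S, SIso w r := by
  let C := {c : (Fin n → Fin n → Prop) × (Fin n → Γ.powerset) × Fin n //
    ∃ (w : SState PV Γ) (e : _), IsCoding w e c}
  refine ⟨Set.range fun c : C => c.2.choose, Set.finite_range _, ?_⟩
  rintro w rfl
  obtain ⟨e, c, hc⟩ := exists_isCoding w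
  refine ⟨_, ⟨⟨c, w, e, hc⟩, rfl⟩, ?_⟩
  have hex : ∃ (w : SState PV Γ) (e : _), IsCoding w e c := ⟨w, e, hc⟩
  obtain ⟨e', hc'⟩ := hex.choose_spec
  exact hc.sIso hc'

/-- `x` is the top of a `≺`-chain of `n + 1` points of `w`. -/
def HasChainBelow (w : SState PV Γ) : ℕ → ℕ → Prop
  | 0, _ => True
  | n + 1, x => ∃ y ∈ w.carrier, w.lt y x ∧ HasChainBelow w n y

theorem HasChainBelow.exists_chain {w : SState PV Γ} {n x : ℕ} (hx : x ∈ w.carrier)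
    (h : HasChainBelow w n x) :
    ∃ c : ℕ → ℕ, (∀ i < n + 1, c i ∈ w.carrier) ∧
      (∀ i j, i < j → j < n + 1 → w.lt (c i) (c j)) ∧ c n = x := by
  induction n generalizing x with
  | zero => exact ⟨fun _ => x, fun _ _ => hx, fun i j _ _ => by omega, rfl⟩
  | succ n ih =>
    obtain ⟨y, hy, hyx, hch⟩ := h
    obtain ⟨c, hc, hlt, rfl⟩ := ih hy hch
    refine ⟨fun i => if i < n + 1 then c i else x, fun i hi => ?_, fun i j hij hj => ?_, by simp⟩
    · dsimp only
      split_ifs with h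
      · exact hc i h
      · exact hx
    · by_cases hj' : j < n + 1
      · simp only [if_pos hj', if_pos (hij.trans hj')]
        exact hlt i j hij hj'
      · have hi : i < n + 1 := by omega
        simp only [if_pos hi, if_neg hj']
        rcases Nat.lt_succ_iff_lt_or_eq.1 hi with hin | rfl
        · exact w.lt_trans _ _ _ (hlt i n hin (by omega)) hyx
        · exact hyx

theorem length_le_hgt {w : SState PV Γ} {n : ℕ} {c : ℕ → ℕ} (hc : ∀ i < n, c i ∈ w.carrier)
    (hlt : ∀ i j, i < j → j < n → w.lt (c i) (c j)) : n ≤ hgt w := by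
  refine le_csSup ⟨w.carrier.card, ?_⟩ ⟨c, hc, hlt⟩
  rintro m ⟨d, hd, hdlt⟩
  have hinj : Set.InjOn d (Finset.range m) := by
    intro i hi j hj hij
    rw [Finset.coe_range, Set.mem_Iio] at hi hj
    rcases lt_trichotomy i j with h | h | h
    · exact absurd (hij ▸ hdlt i j h hj) (w.lt_irrefl _)
    · exact h
    · exact absurd (hij ▸ hdlt j i h hi) (w.lt_irrefl _)
  simpa using Finset.card_le_card_of_injOn (s := Finset.range m) (t := w.carrier) d
    (fun i hi => hd i (by simpa using hi)) hinj

theorem card_daughters_le_wdt {w : SState PV Γ} {x : ℕ} (hx : x ∈ w.carrier) :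
    (w.carrier.filter fun y => IsDaughter w y x).card ≤ wdt w := by
  refine le_csSup ⟨w.carrier.card, ?_⟩ ⟨x, hx, _, rfl, fun y hy => (Finset.mem_filter.1 hy).2, ?_⟩
  · rintro m ⟨y, -, D, rfl, hD, -⟩
    exact Finset.card_le_card fun z hz => (hD z hz).1
  · intro y hy z hz _
    have hy' := (Finset.mem_filter.1 hy).2
    have hz' := (Finset.mem_filter.1 hz).2
    exact ⟨fun h => hy'.2.2 ⟨z, hz'.1, h, hz'.2.1⟩, fun h => hz'.2.2 ⟨y, hy'.1, h, hy'.2.1⟩⟩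

theorem exists_daughter {w : SState PV Γ} {u x : ℕ} (hu : u ∈ w.carrier) (hux : w.lt u x) :
    ∃ y, IsDaughter w y x ∧ (w.lt u y ∨ u = y) := by
  obtain ⟨y, hy, hmax⟩ := Finset.exists_max_image
    (w.carrier.filter fun y => w.lt y x ∧ (w.lt u y ∨ u = y))
    (fun y => (w.carrier.filter fun z => w.lt z y).card)
    ⟨u, Finset.mem_filter.2 ⟨hu, hux, Or.inr rfl⟩⟩
  obtain ⟨hyw, hyx, huy⟩ := Finset.mem_filter.1 hy
  refine ⟨y, ⟨hyw, hyx, ?_⟩, huy⟩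
  rintro ⟨z, hz, hyz, hzx⟩
  have huz : w.lt u z := by
    rcases huy with h | rfl
    · exact w.lt_trans _ _ _ h hyz
    · exact hyz
  refine (hmax z (Finset.mem_filter.2 ⟨hz, hzx, Or.inl huz⟩)).not_gt (Finset.card_lt_card ?_)
  refine Finset.ssubset_iff_subset_ne.2 ⟨fun a ha => ?_, fun heq => ?_⟩
  · obtain ⟨ha1, ha2⟩ := Finset.mem_filter.1 ha
    exact Finset.mem_filter.2 ⟨ha1, w.lt_trans _ _ _ ha2 hyz⟩
  · have : y ∈ w.carrier.filter fun a => w.lt a y := by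
      rw [heq]
      exact Finset.mem_filter.2 ⟨hyw, hyz⟩
    exact w.lt_irrefl _ (Finset.mem_filter.1 this).2

theorem card_substateAt_le (N : ℕ) : ∀ h : ℕ, ∃ B : ℕ, ∀ (w : SState PV Γ) (x : ℕ)
    (hx : x ∈ w.carrier), wdt w ≤ N → ¬ HasChainBelow w h x →
      (w.substateAt x hx).carrier.card ≤ B := by
  intro h
  induction h with
  | zero => exact ⟨0, fun w x hx _ hc => absurd trivial hc⟩
  | succ h ih =>
    obtain ⟨B, hB⟩ := ih
    refine ⟨N * B + 1, fun w x hx hw hc => ?_⟩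
    let D := w.carrier.filter fun y => IsDaughter w y x
    let below : ℕ → Finset ℕ := fun y => w.carrier.filter fun u => w.lt u y ∨ u = y
    have hsub : (w.substateAt x hx).carrier ⊆ insert x (D.biUnion below) := by
      intro u hu
      obtain ⟨hu1, hu2 | rfl⟩ := mem_carrier_substateAt.1 hu
      · obtain ⟨y, hy, huy⟩ := exists_daughter hu1 hu2
        refine Finset.mem_insert_of_mem (Finset.mem_biUnion.2 ⟨y, ?_, ?_⟩)
        · exact Finset.mem_filter.2 ⟨hy.1, hy⟩
        · exact Finset.mem_filter.2 ⟨hu1, huy⟩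
      · exact Finset.mem_insert_self _ _
    have hDB : (D.biUnion below).card ≤ D.card * B := by
      refine Finset.card_biUnion_le_card_mul _ _ _ fun y hy => ?_
      obtain ⟨hy1, hy2⟩ := Finset.mem_filter.1 hy
      exact hB w y hy1 hw fun hch => hc ⟨y, hy1, hy2.2.1, hch⟩
    calc (w.substateAt x hx).carrier.card ≤ (insert x (D.biUnion below)).card :=
          Finset.card_le_card hsub
      _ ≤ (D.biUnion below).card + 1 := Finset.card_insert_le _ _
      _ ≤ N * B + 1 := by
          have := Nat.mul_le_mul_right B ((card_daughters_le_wdt hx).trans hw)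
          exact Nat.succ_le_succ (hDB.trans this)

theorem exists_card_bound (N : ℕ) :
    ∃ B : ℕ, ∀ w : SState PV Γ, snorm w ≤ N → w.carrier.card ≤ B := by
  obtain ⟨B, hB⟩ := card_substateAt_le (PV := PV) (Γ := Γ) N N
  refine ⟨B, fun w hw => ?_⟩
  have hsub : w.carrier ⊆ (w.substateAt w.root w.root_mem).carrier := fun a ha => by
    refine mem_carrier_substateAt.2 ⟨ha, ?_⟩
    by_cases har : a = w.root
    · exact Or.inr har
    · exact Or.inl (w.root_top a ha har)
  refine (Finset.card_le_card hsub).trans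
    (hB w w.root w.root_mem ((le_max_right _ _).trans hw) fun hch => ?_)
  obtain ⟨c, hc, hlt, -⟩ := hch.exists_chain w.root_mem
  have h1 := length_le_hgt hc hlt
  have h2 : hgt w ≤ N := (le_max_left _ _).trans hw
  omega

/-- Up to isomorphism there are finitely many states of bounded norm. -/
theorem exists_finite_representatives (N : ℕ) :
    ∃ S : Set (SState PV Γ), S.Finite ∧
      ∀ w : SState PV Γ, snorm w ≤ N → ∃ r ∈ S, SIso w r := by
  obtain ⟨B, hB⟩ := exists_card_bound (PV := PV) (Γ := Γ) N
  choose S hS hrep using exists_finite_representatives_of_card_eq (PV := PV) (Γ := Γ)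
  refine ⟨⋃ n ∈ Set.Iic B, S n, (Set.finite_Iic B).biUnion fun n _ => hS n, fun w hw => ?_⟩
  obtain ⟨r, hr, hiso⟩ := hrep _ w rfl
  exact ⟨r, Set.mem_biUnion (hB w hw) hr, hiso⟩

theorem card_diaSet_le [DecidableEq PV] (w : SState PV Γ) : (diaSet w).card ≤ Γ.card := by
  refine Finset.card_le_card fun φ hφ => ?_
  obtain ⟨u, hu, hφu⟩ := Finset.mem_biUnion.1 hφ
  exact (w.label_type u hu).subset (Finset.mem_filter.1 hφu).1

theorem snorm_le_of_isChain [DecidableEq PV] {l : List (SState PV Γ)} {v : SState PV Γ}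
    (hl : l.IsChain BFuture) (hv : l.head? = some v) (i : ℕ) (hi : i < l.length) :
    snorm l[i] ≤ snorm v + i * Γ.card := by
  induction i with
  | zero =>
    have : l[0] = v := by
      rw [List.head?_eq_getElem?, List.getElem?_eq_getElem hi] at hv
      exact Option.some.inj hv
    simp [this]
  | succ i ih =>
    have h1 := (List.isChain_iff_getElem.1 hl i hi).2
    have h2 := ih (by omega)
    have h3 := card_diaSet_le l[i]
    rw [Nat.succ_mul]
    omega

theorem exists_length_bound [DecidableEq PV] (v : SState PV Γ) :
    ∃ B : ℕ, ∀ l : List (SState PV Γ), EfficientPath l → l.head? = some v → l.length ≤ B := by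
  by_contra! hcon
  choose L hL hLv hlen using hcon
  have hnorm : ∀ n i, snorm ((L n).getD i v) ≤ snorm v + i * Γ.card := fun n i => by
    by_cases hi : i < (L n).length
    · rw [List.getD_eq_getElem _ _ hi]
      exact snorm_le_of_isChain (hL n).1 (hLv n) i hi
    · rw [List.getD_eq_default _ _ (not_lt.1 hi)]
      exact Nat.le_add_right _ _
  have hlim : ∀ i, ∃ r, ∀ᶠ n in (Filter.hyperfilter ℕ : Filter ℕ), SIso ((L n).getD i v) r := by
    intro i
    obtain ⟨S, hS, hrep⟩ :=
      exists_finite_representatives (PV := PV) (Γ := Γ) (snorm v + i * Γ.card)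
    obtain ⟨r, -, hr⟩ := (Ultrafilter.eventually_exists_mem_iff hS).1
      (Filter.Eventually.of_forall fun n => hrep _ (hnorm n i))
    exact ⟨r, hr⟩
  choose f hf using hlim
  obtain ⟨i, j, hij, hsim⟩ := wellQuasiOrdered_simulates f
  have hge : ∀ᶠ n in (Filter.hyperfilter ℕ : Filter ℕ), j ≤ n :=
    Nat.hyperfilter_le_atTop (Filter.eventually_ge_atTop j)
  obtain ⟨n, hi, hj, hn⟩ := ((hf i).and ((hf j).and hge)).exists
  have hjl : j < (L n).length := hn.trans_lt (hlen n)
  refine (hL n).2 i j (hij.trans hjl) hjl hij ?_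
  have h := (hi.simulates.1.trans hsim).trans hj.simulates.2
  rwa [List.getD_eq_getElem _ _ hjl, List.getD_eq_getElem _ _ (hij.trans hjl)] at h

theorem exists_forall₂_of_forall_mem {α : Type*} {r : α → α → Prop} {S : Set α} {l : List α}
    (h : ∀ a ∈ l, ∃ b ∈ S, r a b) : ∃ l' : List S, List.Forall₂ r l (l'.map Subtype.val) := by
  induction l with
  | nil => exact ⟨[], List.Forall₂.nil⟩
  | cons a l ih =>
    obtain ⟨l', hl'⟩ := ih fun b hb => h b (List.mem_cons_of_mem _ hb)
    obtain ⟨b, hb, hab⟩ := h a List.mem_cons_self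
    exact ⟨⟨b, hb⟩ :: l', List.Forall₂.cons hab hl'⟩

/-- up to isomorphism there are only finitely many efficient
paths of `Σ`-states starting at a given state. -/
theorem finitely_many_efficient_paths {PV : Type} [DecidableEq PV]
    {Γ : Finset (Formula PV)} (hΓ : GoodSigma Γ) (v : SState PV Γ) :
    ∃ P : List (List (SState PV Γ)),
      ∀ l : List (SState PV Γ), EfficientPath l → l.head? = some v →
        ∃ l' ∈ P, List.Forall₂ SIso l l' := by
  obtain ⟨B, hB⟩ := exists_length_bound v
  obtain ⟨S, hS, hrep⟩ := exists_finite_representatives (PV := PV) (Γ := Γ) (snorm v + B * Γ.card)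
  have := hS.to_subtype
  have hfin := (List.finite_length_le S B).image (List.map Subtype.val)
  refine ⟨hfin.toFinset.toList, fun l hl hv => ?_⟩
  have hlen := hB l hl hv
  obtain ⟨l', hl'⟩ := exists_forall₂_of_forall_mem (r := SIso) (S := S) (l := l) fun a ha => by
    obtain ⟨i, hi, rfl⟩ := List.getElem_of_mem ha
    refine hrep _ ((snorm_le_of_isChain hl.1 hv i hi).trans ?_)
    exact Nat.add_le_add_left (Nat.mul_le_mul_right _ (hi.le.trans hlen)) _
  refine ⟨_, ?_, hl'⟩
  rw [Finset.mem_toList, Set.Finite.mem_toFinset]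
  refine ⟨l', ?_, rfl⟩
  have := hl'.length_eq
  rw [List.length_map] at this
  exact this.symm.trans_le hlen

end

end Untangled
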